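/- Let 𝒮 be an η-sparse family of dyadic cubes, σ_1,…,σ_n ∈ A_∞ weights, K : 𝒮 → [0,∞), 1 < p_1,…,p_n < ∞ with 1/p_1 + ⋯ + 1/p_n < 1, and define r by 1/r + ∑ 1/p_i = 1. If A_0 := [∑_{S∈𝒮} (K(S)|S|^{n−1} ∏_{i=1}^n (σ_i(S)/|S|)^{1/p_i'})^r |E_𝒮(S)|]^{1/r} < ∞, then the multilinear embedding inequality ∑_{S∈𝒮} K(S) ∏_{i=1}^n ∫_S f_i dσ_i ≲ A_0 ∏_{i=1}^n ‖f_i‖_{L^{p_i}(σ_i)} holds. -/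

import Mathlib

open MeasureTheory ENNReal

/-- The axis-parallel cube in `ℝ^d` with center `c` and side length `ℓ`. -/
noncomputable def cube (d : ℕ) (c : EuclideanSpace ℝ (Fin d)) (ℓ : ℝ) :
    Set (EuclideanSpace ℝ (Fin d)) := {x | ∀ i, |x i - c i| ≤ ℓ / 2}

/-- The `A_p` characteristic of a weight `w` on `ℝ^d`. -/
noncomputable def apConst (d : ℕ) (p : ℝ) (w : EuclideanSpace ℝ (Fin d) → ℝ≥0∞) : ℝ≥0∞ :=
  ⨆ (c : EuclideanSpace ℝ (Fin d)) (ℓ : ℝ) (_ : 0 < ℓ),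
    ((∫⁻ x in cube d c ℓ, w x) / volume (cube d c ℓ)) *
      ((∫⁻ x in cube d c ℓ, w x ^ (-(1 / (p - 1)))) / volume (cube d c ℓ)) ^ (p - 1)

/-- `w ∈ A_∞` iff `w ∈ A_p` for some `1 < p < ∞`. -/
def isAinfty (d : ℕ) (w : EuclideanSpace ℝ (Fin d) → ℝ≥0∞) : Prop :=
  ∃ p : ℝ, 1 < p ∧ apConst d p w ≠ ⊤

/-- The dyadic cube `2^{-k}(m + [0,1)^d)` in `ℝ^d`. -/
def dyadicCube (d : ℕ) (k : ℤ) (m : Fin d → ℤ) :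
    Set (EuclideanSpace ℝ (Fin d)) :=
  {x | ∀ i, x i ∈ Set.Ico ((2:ℝ) ^ (-k) * m i) ((2:ℝ) ^ (-k) * (m i + 1))}

theorem dyadicCube_eq_ofLp_preimage (d : ℕ) (k : ℤ) (m : Fin d → ℤ) :
    dyadicCube d k m = WithLp.ofLp ⁻¹' (Set.univ.pi fun i =>
      Set.Ico ((2:ℝ) ^ (-k) * m i) ((2:ℝ) ^ (-k) * (m i + 1))) := by
  ext x
  simp [dyadicCube]

theorem measurableSet_dyadicCube (d : ℕ) (k : ℤ) (m : Fin d → ℤ) :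
    MeasurableSet (dyadicCube d k m) := by
  rw [dyadicCube_eq_ofLp_preimage]
  exact (PiLp.volume_preserving_ofLp (Fin d)).measurable
    (MeasurableSet.univ_pi fun _ => measurableSet_Ico)

theorem volume_dyadicCube (d : ℕ) (k : ℤ) (m : Fin d → ℤ) :
    volume (dyadicCube d k m) = ENNReal.ofReal ((2:ℝ) ^ (-k)) ^ d := by
  rw [dyadicCube_eq_ofLp_preimage,
    (PiLp.volume_preserving_ofLp (Fin d)).measure_preimage
      (MeasurableSet.univ_pi fun _ => measurableSet_Ico).nullMeasurableSet, Real.volume_pi_Ico]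
  simp [mul_add]

theorem volume_cube (d : ℕ) (c : EuclideanSpace ℝ (Fin d)) (ℓ : ℝ) :
    volume (cube d c ℓ) = ENNReal.ofReal ℓ ^ d := by
  have h : cube d c ℓ = WithLp.ofLp ⁻¹' (Set.Icc (fun i => c i - ℓ / 2) fun i => c i + ℓ / 2) := by
    ext x
    simp only [cube, abs_le, Set.mem_ofPred_eq, Set.mem_preimage, Set.mem_Icc, Pi.le_def,
      ← forall_and]
    exact forall_congr' fun i => by constructor <;> rintro ⟨h₁, h₂⟩ <;> constructor <;> linarith
  rw [h, (PiLp.volume_preserving_ofLp (Fin d)).measure_preimage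
      measurableSet_Icc.nullMeasurableSet, Real.volume_Icc_pi]
  have : ∀ i, c i + ℓ / 2 - (c i - ℓ / 2) = ℓ := fun i => by ring
  simp [this]

theorem volume_dyadicCube_ne_zero (d : ℕ) (k : ℤ) (m : Fin d → ℤ) :
    volume (dyadicCube d k m) ≠ 0 := by
  rw [volume_dyadicCube]
  exact pow_ne_zero _ (ENNReal.ofReal_pos.2 (by positivity)).ne'

theorem volume_dyadicCube_ne_top (d : ℕ) (k : ℤ) (m : Fin d → ℤ) :
    volume (dyadicCube d k m) ≠ ⊤ := by
  rw [volume_dyadicCube]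
  exact ENNReal.pow_ne_top ENNReal.ofReal_ne_top

/-- A half-open dyadic cube lies in a closed cube of the same volume. -/
theorem exists_dyadicCube_subset_cube (d : ℕ) (k : ℤ) (m : Fin d → ℤ) :
    ∃ c : EuclideanSpace ℝ (Fin d), ∃ ℓ : ℝ, 0 < ℓ ∧ dyadicCube d k m ⊆ cube d c ℓ ∧
      volume (cube d c ℓ) = volume (dyadicCube d k m) := by
  refine ⟨WithLp.toLp 2 fun i => (2:ℝ) ^ (-k) * (m i + 1 / 2), (2:ℝ) ^ (-k), by positivity, ?_, ?_⟩
  · intro x hx i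
    obtain ⟨h₁, h₂⟩ := hx i
    rw [abs_le]
    constructor <;> simp only <;> linarith
  · rw [volume_cube, volume_dyadicCube]

theorem dyadicCube_subset_of_mem {d : ℕ} {k k' : ℤ} {m m' : Fin d → ℤ} (hk : k ≤ k')
    {x : EuclideanSpace ℝ (Fin d)} (hx : x ∈ dyadicCube d k m) (hx' : x ∈ dyadicCube d k' m') :
    dyadicCube d k' m' ⊆ dyadicCube d k m := by
  intro y hy i
  obtain ⟨N, hN⟩ := Int.eq_ofNat_of_zero_le (sub_nonneg.2 hk)
  have hscale : (2:ℝ) ^ (-k) = (2:ℝ) ^ (-k') * ((2 ^ N : ℤ) : ℝ) := by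
    rw [show -k = -k' + (N : ℤ) by linarith, zpow_add₀ two_ne_zero]
    simp
  have hpos : (0:ℝ) < (2:ℝ) ^ (-k') := by positivity
  obtain ⟨a₁, a₂⟩ := hx i
  obtain ⟨b₁, b₂⟩ := hx' i
  obtain ⟨c₁, c₂⟩ := hy i
  rw [hscale, mul_assoc] at a₁ a₂ ⊢
  have h₁ : (2 ^ N : ℤ) * m i < m' i + 1 := by
    exact_mod_cast lt_of_mul_lt_mul_left (a₁.trans_lt b₂) hpos.le
  have h₂ : m' i < (2 ^ N : ℤ) * (m i + 1) := by
    exact_mod_cast lt_of_mul_lt_mul_left (b₁.trans_lt a₂) hpos.le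
  have h₁' : ((2 ^ N : ℤ) : ℝ) * m i ≤ m' i := by exact_mod_cast Int.lt_add_one_iff.1 h₁
  have h₂' : (m' i : ℝ) + 1 ≤ ((2 ^ N : ℤ) : ℝ) * (m i + 1) := by exact_mod_cast h₂
  rw [mul_assoc]
  exact ⟨(mul_le_mul_of_nonneg_left h₁' hpos.le).trans c₁,
    c₂.trans_le (mul_le_mul_of_nonneg_left h₂' hpos.le)⟩

theorem dyadicCube_nested_or_disjoint {d : ℕ} (k k' : ℤ) (m m' : Fin d → ℤ) :
    dyadicCube d k m ⊆ dyadicCube d k' m' ∨ dyadicCube d k' m' ⊆ dyadicCube d k m ∨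
      Disjoint (dyadicCube d k m) (dyadicCube d k' m') := by
  by_cases h : Disjoint (dyadicCube d k m) (dyadicCube d k' m')
  · exact .inr (.inr h)
  obtain ⟨x, hx, hx'⟩ := Set.not_disjoint_iff.1 h
  rcases le_total k k' with hk | hk
  · exact .inr (.inl (dyadicCube_subset_of_mem hk hx hx'))
  · exact .inl (dyadicCube_subset_of_mem hk hx' hx)

/-- A finite family of sets, any two nested or disjoint, has a pairwise disjoint subfamily with the
same union. -/
theorem exists_disjoint_subfamily_biUnion_eq {α ι : Type*} {S : ι → Set α}
    (hS : ∀ i j, S i ⊆ S j ∨ S j ⊆ S i ∨ Disjoint (S i) (S j)) (F : Finset ι) :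
    ∃ G ⊆ F, (G : Set ι).PairwiseDisjoint S ∧ ⋃ j ∈ G, S j = ⋃ j ∈ F, S j := by
  classical
  induction F using Finset.induction_on with
  | empty => exact ⟨∅, subset_rfl, by simp, rfl⟩
  | insert a F _ ih =>
    obtain ⟨G, hGF, hG, hU⟩ := ih
    by_cases ha : ∃ i ∈ G, S a ⊆ S i
    · obtain ⟨i, hi, hai⟩ := ha
      refine ⟨G, hGF.trans (Finset.subset_insert _ _), hG, ?_⟩
      rw [Finset.set_biUnion_insert, ← hU, eq_comm, Set.union_eq_right]
      exact hai.trans (Set.subset_biUnion_of_mem (u := S) hi)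
    · push Not at ha
      refine ⟨insert a (G.filter fun i => Disjoint (S a) (S i)),
        Finset.insert_subset_insert _ ((Finset.filter_subset _ _).trans hGF), ?_, ?_⟩
      · rw [Finset.coe_insert]
        refine (hG.subset (Finset.coe_subset.2 (Finset.filter_subset _ _))).insert ?_
        intro j hj _
        exact (Finset.mem_filter.1 hj).2
      · rw [Finset.set_biUnion_insert, Finset.set_biUnion_insert, ← hU]
        apply subset_antisymm
        · exact Set.union_subset_union_right _
            (Set.biUnion_subset_biUnion_left (Finset.filter_subset _ _))
        · refine Set.union_subset Set.subset_union_left (Set.iUnion₂_subset fun i hi => ?_)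
          rcases hS a i with h | h | h
          · exact absurd h (ha i hi)
          · exact h.trans Set.subset_union_left
          · exact (Set.subset_biUnion_of_mem (u := S) (Finset.mem_filter.2 ⟨hi, h⟩)).trans
              Set.subset_union_right

theorem lintegral_rpow_layer (q : ℝ) (hq : 0 < q) (y : ℝ≥0∞) :
    ∫⁻ t in Set.Ioi (0:ℝ), (if ENNReal.ofReal t < y then ENNReal.ofReal (q * t ^ (q - 1)) else 0)
      = y ^ q := by
  have key : ∀ z : NNReal, ∫⁻ t in Set.Ioi (0:ℝ),
      (if ENNReal.ofReal t < z then ENNReal.ofReal (q * t ^ (q - 1)) else 0) = (z : ℝ≥0∞) ^ q := by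
    intro z
    have h := lintegral_rpow_eq_lintegral_meas_lt_mul (Measure.dirac ()) (f := fun _ => (z : ℝ))
      (Filter.Eventually.of_forall fun _ => z.2) aemeasurable_const hq
    rw [lintegral_const, Measure.dirac_apply_of_mem (Set.mem_univ _), mul_one,
      ← lintegral_const_mul' _ _ ENNReal.ofReal_ne_top,
      ← ENNReal.ofReal_rpow_of_nonneg z.coe_nonneg hq.le, ENNReal.ofReal_coe_nnreal] at h
    rw [h]
    refine setLIntegral_congr_fun measurableSet_Ioi fun t ht => ?_
    have hiff : ENNReal.ofReal t < z ↔ t < z := by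
      rw [← ENNReal.ofReal_coe_nnreal, ENNReal.ofReal_lt_ofReal_iff_of_nonneg (le_of_lt ht)]
    by_cases hz : t < z <;> simp [hiff, hz, ENNReal.ofReal_mul hq.le]
  induction y with
  | coe z => exact key z
  | top =>
    rw [ENNReal.top_rpow_of_pos hq]
    refine ENNReal.eq_top_of_forall_nnreal_le fun s => ?_
    have hs : (s : ℝ≥0∞) = ((s ^ q⁻¹ : NNReal) : ℝ≥0∞) ^ q := by
      rw [← ENNReal.coe_rpow_of_nonneg _ hq.le, ← NNReal.rpow_mul, inv_mul_cancel₀ hq.ne',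
        NNReal.rpow_one]
    rw [hs, ← key]
    refine lintegral_mono fun t => ?_
    simp only [ENNReal.ofReal_lt_top, if_true]
    split_ifs <;> simp

/-- Weak-type bound for averages over a finite family of sets, any two nested or disjoint. -/
theorem sum_measure_mul_le_lintegral {α ι : Type*} [MeasurableSpace α] (μ : Measure α)
    {S E : ι → Set α} (hSm : ∀ j, MeasurableSet (S j))
    (hS : ∀ i j, S i ⊆ S j ∨ S j ⊆ S i ∨ Disjoint (S i) (S j))
    (hEm : ∀ j, MeasurableSet (E j)) (hES : ∀ j, E j ⊆ S j)
    (hE : Pairwise (Function.onFun Disjoint E)) {f : α → ℝ≥0∞}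
    (F : Finset ι) {t : ℝ≥0∞} (ht : t ≠ ⊤)
    (hF : ∀ j ∈ F, t < (∫⁻ x in S j, f x ∂μ) / μ (S j)) :
    t / 2 * ∑ j ∈ F, μ (E j) ≤ ∫⁻ x, (if t < 2 * f x then f x else 0) ∂μ := by
  obtain ⟨G, hGF, hG, hU⟩ := exists_disjoint_subfamily_biUnion_eq hS F
  set U := ⋃ j ∈ F, S j with hUdef
  have hUm : MeasurableSet U := Finset.measurableSet_biUnion _ fun j _ => hSm j
  have hfin : ∀ j ∈ F, μ (S j) ≠ ⊤ := by
    intro j hj h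
    have := hF j hj
    simp [h] at this
  have hUfin : μ U ≠ ⊤ := by
    refine ((measure_biUnion_finset_le F S).trans_lt ?_).ne
    exact ENNReal.sum_lt_top.2 fun j hj => (hfin j hj).lt_top
  have hEU : ∑ j ∈ F, μ (E j) ≤ μ U := by
    rw [← measure_biUnion_finset (fun i _ j _ hij => hE hij) fun j _ => hEm j]
    exact measure_mono (Set.iUnion₂_mono fun j _ => hES j)
  have hweak : t * μ U ≤ ∫⁻ x in U, f x ∂μ := by
    rw [← hU, measure_biUnion_finset hG fun j _ => hSm j,
      lintegral_biUnion_finset hG fun j _ => hSm j, Finset.mul_sum]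
    refine Finset.sum_le_sum fun j hj => ?_
    calc t * μ (S j) ≤ (∫⁻ x in S j, f x ∂μ) / μ (S j) * μ (S j) := by
          gcongr
          exact (hF j (hGF hj)).le
      _ ≤ ∫⁻ x in S j, f x ∂μ := by
          rw [mul_comm]
          exact ENNReal.mul_div_le
  have hsplit : ∫⁻ x in U, f x ∂μ ≤
      t / 2 * μ U + ∫⁻ x, (if t < 2 * f x then f x else 0) ∂μ := by
    calc ∫⁻ x in U, f x ∂μ
        ≤ ∫⁻ x in U, (t / 2 + if t < 2 * f x then f x else 0) ∂μ := by
          refine lintegral_mono fun x => ?_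
          split_ifs with h
          · exact le_add_self
          · rw [add_zero, ENNReal.le_div_iff_mul_le (by simp) (by simp), mul_comm]
            exact not_lt.1 h
      _ = t / 2 * μ U + ∫⁻ x in U, (if t < 2 * f x then f x else 0) ∂μ := by
          rw [lintegral_add_left measurable_const, setLIntegral_const]
      _ ≤ _ := by gcongr; exact Measure.restrict_le_self
  have hhalf : t * μ U = t / 2 * μ U + t / 2 * μ U := by rw [← add_mul, ENNReal.add_halves]
  have hne : t / 2 * μ U ≠ ⊤ :=
    ENNReal.mul_ne_top (ENNReal.div_ne_top ht (by simp)) hUfin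
  refine (mul_le_mul_right hEU _).trans ?_
  exact (ENNReal.add_le_add_iff_left hne).1 (hhalf ▸ hweak.trans hsplit)

/-- Carleson embedding theorem: a maximal function bound in discrete form. -/
theorem tsum_average_rpow_mul_measure_le {α ι : Type*} [MeasurableSpace α] (μ : Measure α)
    [SFinite μ] {S E : ι → Set α} (hSm : ∀ j, MeasurableSet (S j))
    (hS : ∀ i j, S i ⊆ S j ∨ S j ⊆ S i ∨ Disjoint (S i) (S j))
    (hEm : ∀ j, MeasurableSet (E j)) (hES : ∀ j, E j ⊆ S j)
    (hE : Pairwise (Function.onFun Disjoint E)) {f : α → ℝ≥0∞} (hf : Measurable f)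
    {p : ℝ} (hp : 1 < p) :
    ∑' j, ((∫⁻ x in S j, f x ∂μ) / μ (S j)) ^ p * μ (E j) ≤
      ENNReal.ofReal (2 * p / (p - 1)) * 2 ^ (p - 1) * ∫⁻ x, f x ^ p ∂μ := by
  have hp0 : 0 < p := by linarith
  have hp1 : 0 < p - 1 := by linarith
  rw [ENNReal.tsum_eq_iSup_sum]
  refine iSup_le fun F => ?_
  set a : ι → ℝ≥0∞ := fun j => (∫⁻ x in S j, f x ∂μ) / μ (S j)
  set w : ℝ → ℝ≥0∞ := fun t =>
    ENNReal.ofReal (2 * p / (p - 1)) * ENNReal.ofReal ((p - 1) * t ^ (p - 1 - 1))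
  have hw : Measurable w := by fun_prop
  have hlevel : ∀ t ∈ Set.Ioi (0:ℝ),
      ∑ j ∈ F, (if ENNReal.ofReal t < a j then ENNReal.ofReal (p * t ^ (p - 1)) else 0) * μ (E j) ≤
        ∫⁻ x, (if ENNReal.ofReal t < 2 * f x then w t * f x else 0) ∂μ := by
    intro t ht
    have ht : 0 < t := ht
    have hpt : ENNReal.ofReal (p * t ^ (p - 1)) = w t * (ENNReal.ofReal t / 2) := by
      have h2 : ENNReal.ofReal t / 2 = ENNReal.ofReal (t / 2) := by
        rw [ENNReal.ofReal_div_of_pos two_pos]; simp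
      rw [h2]
      simp only [w]
      rw [← ENNReal.ofReal_mul (by positivity), ← ENNReal.ofReal_mul (by positivity),
        Real.rpow_sub_one ht.ne' (p - 1)]
      congr 1
      field_simp
    calc _ = w t * (ENNReal.ofReal t / 2 *
          ∑ j ∈ F.filter (fun j => ENNReal.ofReal t < a j), μ (E j)) := by
          rw [← mul_assoc, ← hpt, Finset.mul_sum, Finset.sum_filter]
          exact Finset.sum_congr rfl fun j _ => by split_ifs <;> simp
      _ ≤ w t * ∫⁻ x, (if ENNReal.ofReal t < 2 * f x then f x else 0) ∂μ := by
          gcongr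
          exact sum_measure_mul_le_lintegral μ hSm hS hEm hES hE _ ENNReal.ofReal_ne_top
            fun j hj => (Finset.mem_filter.1 hj).2
      _ = _ := by
          rw [← lintegral_const_mul' _ _
            (ENNReal.mul_ne_top ENNReal.ofReal_ne_top ENNReal.ofReal_ne_top)]
          simp only [mul_ite, mul_zero, w]
  calc ∑ j ∈ F, a j ^ p * μ (E j)
      = ∫⁻ t in Set.Ioi (0:ℝ), ∑ j ∈ F,
          (if ENNReal.ofReal t < a j then ENNReal.ofReal (p * t ^ (p - 1)) else 0) * μ (E j) := by
        have hm : ∀ j, Measurable fun t : ℝ =>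
            if ENNReal.ofReal t < a j then ENNReal.ofReal (p * t ^ (p - 1)) else 0 := fun j =>
          Measurable.ite (measurableSet_lt ENNReal.measurable_ofReal measurable_const)
            (by fun_prop) measurable_const
        rw [lintegral_finsetSum _ fun j _ => (hm j).mul_const _]
        refine Finset.sum_congr rfl fun j _ => ?_
        rw [lintegral_mul_const _ (hm j), lintegral_rpow_layer p hp0]
    _ ≤ ∫⁻ t in Set.Ioi (0:ℝ), ∫⁻ x,
          (if ENNReal.ofReal t < 2 * f x then w t * f x else 0) ∂μ :=
        setLIntegral_mono' measurableSet_Ioi hlevel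
    _ = ∫⁻ x, (∫⁻ t in Set.Ioi (0:ℝ),
          if ENNReal.ofReal t < 2 * f x then w t * f x else 0) ∂μ := by
        refine lintegral_lintegral_swap (Measurable.aemeasurable ?_)
        refine Measurable.ite (measurableSet_lt (by fun_prop) (by fun_prop)) ?_ measurable_const
        exact (hw.comp measurable_fst).mul (hf.comp measurable_snd)
    _ = ∫⁻ x, ENNReal.ofReal (2 * p / (p - 1)) * 2 ^ (p - 1) * f x ^ p ∂μ := by
        refine lintegral_congr fun x => ?_
        have hm : Measurable fun t : ℝ => if ENNReal.ofReal t < 2 * f x then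
            ENNReal.ofReal ((p - 1) * t ^ (p - 1 - 1)) else 0 :=
          Measurable.ite (measurableSet_lt ENNReal.measurable_ofReal measurable_const)
            (by fun_prop) measurable_const
        calc _ = ∫⁻ t in Set.Ioi (0:ℝ), ENNReal.ofReal (2 * p / (p - 1)) *
              (if ENNReal.ofReal t < 2 * f x then
                ENNReal.ofReal ((p - 1) * t ^ (p - 1 - 1)) else 0) * f x := by
              refine lintegral_congr fun t => ?_
              split_ifs <;> simp [w]
          _ = _ := by
              rw [lintegral_mul_const _ (hm.const_mul _), lintegral_const_mul _ hm,
                lintegral_rpow_layer _ hp1, ENNReal.mul_rpow_of_nonneg _ _ hp1.le, mul_assoc,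
                mul_assoc, mul_assoc]
              congr 2
              conv_rhs => rw [show p = (p - 1) + 1 by ring,
                ENNReal.rpow_add_of_nonneg _ _ hp1.le zero_le_one, ENNReal.rpow_one]
    _ = _ := lintegral_const_mul _ (by fun_prop)

/-- The `A_p` condition compares the weight of a cube with the weight of a large portion. -/
theorem exists_setLIntegral_dyadicCube_le {d : ℕ} {w : EuclideanSpace ℝ (Fin d) → ℝ≥0∞}
    (hwm : Measurable w) (hw : isAinfty d w) {η : ℝ} (hη : 0 < η) :
    ∃ C : ℝ≥0∞, C ≠ ⊤ ∧ ∀ (k : ℤ) (m : Fin d → ℤ) (E : Set (EuclideanSpace ℝ (Fin d))),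
      MeasurableSet E → E ⊆ dyadicCube d k m →
      ENNReal.ofReal η * volume (dyadicCube d k m) ≤ volume E →
      ∫⁻ x in dyadicCube d k m, w x ≠ ⊤ →
      ∫⁻ x in dyadicCube d k m, w x ≤ C * ∫⁻ x in E, w x := by
  obtain ⟨p, hp, hA⟩ := hw
  have hp0 : 0 < p := by linarith
  have hp1 : 0 < p - 1 := by linarith
  refine ⟨apConst d p w / ENNReal.ofReal η ^ p, ENNReal.div_ne_top hA
    (by simp [ENNReal.rpow_eq_zero_iff, hη]), ?_⟩
  intro k m E hEm hES hηE hfin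
  set S := dyadicCube d k m
  set v := volume S
  have hv0 : v ≠ 0 := volume_dyadicCube_ne_zero d k m
  have hvt : v ≠ ⊤ := volume_dyadicCube_ne_top d k m
  set W := ∫⁻ x in S, w x
  set V := ∫⁻ x in S, w x ^ (-(1 / (p - 1)))
  rcases eq_or_ne W 0 with hW0 | hW0
  · simp [hW0]
  have hAp : W / v * (V / v) ^ (p - 1) ≤ apConst d p w := by
    obtain ⟨c, ℓ, hℓ, hsub, hvol⟩ := exists_dyadicCube_subset_cube d k m
    refine le_trans ?_ (le_iSup_of_le c (le_iSup_of_le ℓ (le_iSup_of_le hℓ le_rfl)))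
    rw [hvol]
    gcongr <;> exact lintegral_mono_set hsub
  have hVt : V ≠ ⊤ := by
    intro hV
    rw [hV, ENNReal.top_div_of_ne_top hvt, ENNReal.top_rpow_of_pos hp1,
      ENNReal.mul_top (ENNReal.div_pos hW0 hvt).ne'] at hAp
    exact hA (top_le_iff.1 hAp)
  have hAp' : W * V ^ (p - 1) ≤ apConst d p w * v ^ p := by
    have hvp : v ^ p = v * v ^ (p - 1) := by
      conv_lhs => rw [← add_sub_cancel 1 p, ENNReal.rpow_add _ _ hv0 hvt, ENNReal.rpow_one]
    calc W * V ^ (p - 1) = (W / v * (V / v) ^ (p - 1)) * v ^ p := by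
          rw [hvp, ENNReal.div_rpow_of_nonneg _ _ hp1.le]
          have hq0 : v ^ (p - 1) ≠ 0 := (ENNReal.rpow_pos (pos_iff_ne_zero.2 hv0) hvt).ne'
          have hqt : v ^ (p - 1) ≠ ⊤ := ENNReal.rpow_ne_top_of_nonneg hp1.le hvt
          rw [mul_mul_mul_comm, ENNReal.div_mul_cancel hv0 hvt, ENNReal.div_mul_cancel hq0 hqt]
      _ ≤ _ := by gcongr
  have hE : volume E ^ p ≤ (∫⁻ x in E, w x) * V ^ (p - 1) := by
    have hw_ne_top : ∀ᵐ x ∂volume.restrict E, w x ≠ ⊤ := by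
      have := ae_lt_top hwm hfin
      filter_upwards [ae_restrict_of_ae_restrict_of_subset hES this] with x hx using hx.ne
    have hw_ne_zero : ∀ᵐ x ∂volume.restrict E, w x ≠ 0 := by
      have := ae_lt_top (by fun_prop) hVt
      filter_upwards [ae_restrict_of_ae_restrict_of_subset hES this] with x hx h0
      simp [h0, hp] at hx
    have hHolder : volume E ≤ (∫⁻ x in E, w x) ^ (1 / p) * V ^ (1 - 1 / p) := by
      have h1p : 1 / p ≤ 1 := by rw [div_le_one hp0]; exact hp.le
      calc volume E = ∫⁻ x in E, 1 := by simp
        _ = ∫⁻ x in E, w x ^ (1 / p) * (w x ^ (-(1 / (p - 1)))) ^ (1 - 1 / p) := by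
          refine lintegral_congr_ae ?_
          filter_upwards [hw_ne_top, hw_ne_zero] with x hx hx0
          rw [← ENNReal.rpow_mul, ← ENNReal.rpow_add _ _ hx0 hx]
          rw [show 1 / p + -(1 / (p - 1)) * (1 - 1 / p) = 0 by field_simp; ring, ENNReal.rpow_zero]
        _ ≤ (∫⁻ x in E, w x) ^ (1 / p) *
            (∫⁻ x in E, w x ^ (-(1 / (p - 1)))) ^ (1 - 1 / p) :=
          ENNReal.lintegral_mul_norm_pow_le (by fun_prop) (by fun_prop) (by positivity)
            (by linarith) (by ring)
        _ ≤ _ := by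
          gcongr
          exact lintegral_mono_set hES
    calc volume E ^ p ≤ ((∫⁻ x in E, w x) ^ (1 / p) * V ^ (1 - 1 / p)) ^ p := by gcongr
      _ = _ := by
        rw [ENNReal.mul_rpow_of_nonneg _ _ hp0.le, ← ENNReal.rpow_mul, ← ENNReal.rpow_mul,
          one_div_mul_cancel hp0.ne', ENNReal.rpow_one, sub_mul, one_div_mul_cancel hp0.ne',
          one_mul]
  have hfinal : ENNReal.ofReal η ^ p * v ^ p * W ≤ apConst d p w * (∫⁻ x in E, w x) * v ^ p := by
    calc ENNReal.ofReal η ^ p * v ^ p * W ≤ volume E ^ p * W := by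
          rw [← ENNReal.mul_rpow_of_nonneg _ _ hp0.le]; gcongr
      _ ≤ (∫⁻ x in E, w x) * V ^ (p - 1) * W := by gcongr
      _ = (∫⁻ x in E, w x) * (W * V ^ (p - 1)) := by ring
      _ ≤ (∫⁻ x in E, w x) * (apConst d p w * v ^ p) := by gcongr
      _ = _ := by ring
  rw [mul_right_comm, ENNReal.mul_le_mul_iff_left (by simp [ENNReal.rpow_eq_zero_iff, hv0, hvt])
    (by simp [hv0, hvt])] at hfinal
  rw [← ENNReal.mul_div_right_comm, ENNReal.le_div_iff_mul_le 
    (.inl (by simp [ENNReal.rpow_eq_zero_iff, hη])) (.inl (by simp [hp0.le])), mul_comm]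
  exact hfinal

/-- Hölder's inequality for sums with several factors. -/
theorem ENNReal.tsum_mul_prod_rpow_le {ι κ : Type*} [Fintype κ] (g : ι → ℝ≥0∞)
    (f : κ → ι → ℝ≥0∞) {q : ℝ} {p : κ → ℝ} (hpq : q + ∑ i, p i = 1) (hq : 0 ≤ q)
    (hp : ∀ i, 0 ≤ p i) :
    ∑' j, g j ^ q * ∏ i, f i j ^ p i ≤ (∑' j, g j) ^ q * ∏ i, (∑' j, f i j) ^ p i := by
  let _ : MeasurableSpace ι := ⊤
  simpa only [lintegral_count] using
    ENNReal.lintegral_mul_prod_norm_pow_le (μ := Measure.count) Finset.univ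
      (measurable_from_top (f := g)).aemeasurable
      (fun i _ => (measurable_from_top (f := f i)).aemeasurable) q hpq hq fun i _ => hp i

/-- The powers of the volume in the testing functional cancel against Hölder's inequality. -/
theorem mul_prod_eq_testing_mul_prod {n : ℕ} {p : Fin n → ℝ} (hp : ∀ i, 1 < p i) {s : ℝ}
    (hs : s + ∑ i, 1 / p i = 1) {v : ℝ≥0∞} (hv0 : v ≠ 0) (hvt : v ≠ ⊤) (K : ℝ≥0∞)
    {W : Fin n → ℝ≥0∞} (hW0 : ∀ i, W i ≠ 0) (hWt : ∀ i, W i ≠ ⊤) (I : Fin n → ℝ≥0∞) :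
    K * ∏ i, I i = K * v ^ ((n : ℝ) - 1) * (∏ i, (W i / v) ^ (1 - 1 / p i)) * v ^ s *
      ∏ i, (I i / W i * W i ^ (1 / p i)) := by
  have hq : ∀ i, 0 ≤ 1 - 1 / p i := fun i => by
    have := (div_le_one (zero_lt_one.trans (hp i))).2 (hp i).le
    linarith
  have hprod : ∏ i, I i = (∏ i, (W i / v) ^ (1 - 1 / p i)) * (∏ i, v ^ (1 - 1 / p i)) *
      ∏ i, (I i / W i * W i ^ (1 / p i)) := by
    rw [← Finset.prod_mul_distrib, ← Finset.prod_mul_distrib]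
    refine Finset.prod_congr rfl fun i _ => ?_
    rw [← ENNReal.mul_rpow_of_nonneg _ _ (hq i), ENNReal.div_mul_cancel hv0 hvt, mul_left_comm,
      ← ENNReal.rpow_add _ _ (hW0 i) (hWt i), sub_add_cancel, ENNReal.rpow_one,
      ENNReal.div_mul_cancel (hW0 i) (hWt i)]
  have hv : v ^ ((n : ℝ) - 1) * v ^ s = ∏ i, v ^ (1 - 1 / p i) := by
    have : ∏ i, v ^ (1 - 1 / p i) = v ^ ∑ i, (1 - 1 / p i) := by
      induction (Finset.univ : Finset (Fin n)) using Finset.induction_on with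
      | empty => simp
      | insert a F ha ih =>
        rw [Finset.prod_insert ha, Finset.sum_insert ha, ENNReal.rpow_add _ _ hv0 hvt, ih]
    rw [this, ← ENNReal.rpow_add _ _ hv0 hvt, Finset.sum_sub_distrib]
    congr 1
    simp only [Finset.sum_const, Finset.card_univ, Fintype.card_fin, nsmul_eq_mul, mul_one]
    linarith
  rw [hprod, ← hv]
  ring

/-- Theorem 2.2(a): for `σᵢ ∈ A_∞`, `∑ 1/pᵢ < 1` and `1/r + ∑ 1/pᵢ = 1`, if
`A₀ = [∑_S (K(S)|S|^{n-1} ∏ (σᵢ(S)/|S|)^{1/pᵢ'})^r |E_𝒮(S)|]^{1/r} < ∞`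
(here `1/pᵢ' = 1 - 1/pᵢ`), then the multilinear embedding inequality holds. -/
theorem stmt9 (d n : ℕ) (hn : 0 < n) (p : Fin n → ℝ) (hp : ∀ i, 1 < p i)
    (hsum : ∑ i, 1 / p i < 1) (r : ℝ) (hr : 1 / r + ∑ i, 1 / p i = 1)
    (η : ℝ) (hη0 : 0 < η) (hη1 : η < 1)
    (σ : Fin n → EuclideanSpace ℝ (Fin d) → ℝ≥0∞) (hσm : ∀ i, Measurable (σ i))
    (hσA : ∀ i, isAinfty d (σ i)) :
    ∃ C : ℝ≥0∞, C ≠ ⊤ ∧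
      ∀ (ι : Type) (_ : Countable ι) (k : ι → ℤ) (m : ι → Fin d → ℤ)
        (E : ι → Set (EuclideanSpace ℝ (Fin d)))
        (_ : ∀ j, MeasurableSet (E j))
        (_ : ∀ j, E j ⊆ dyadicCube d (k j) (m j))
        (_ : ∀ j, ENNReal.ofReal η * volume (dyadicCube d (k j) (m j)) ≤ volume (E j))
        (_ : Pairwise (Function.onFun Disjoint E))
        (K : ι → ℝ≥0∞)
        (_ : (∑' j, (K j * volume (dyadicCube d (k j) (m j)) ^ ((n : ℝ) - 1) *
            ∏ i, ((∫⁻ x in dyadicCube d (k j) (m j), σ i x) /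
              volume (dyadicCube d (k j) (m j))) ^ (1 - 1 / p i)) ^ r *
            volume (E j)) ^ (1 / r) ≠ ⊤)
        (f : Fin n → EuclideanSpace ℝ (Fin d) → ℝ≥0∞) (_ : ∀ i, Measurable (f i)),
        (∑' j, K j * ∏ i, ∫⁻ x in dyadicCube d (k j) (m j), f i x * σ i x) ≤
          C * (∑' j, (K j * volume (dyadicCube d (k j) (m j)) ^ ((n : ℝ) - 1) *
              ∏ i, ((∫⁻ x in dyadicCube d (k j) (m j), σ i x) /
                volume (dyadicCube d (k j) (m j))) ^ (1 - 1 / p i)) ^ r *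
              volume (E j)) ^ (1 / r) *
            ∏ i, (∫⁻ x, f i x ^ p i * σ i x) ^ (1 / p i) := by

  have hp0 : ∀ i, 0 < p i := fun i => zero_lt_one.trans (hp i)
  have hr1 : 0 < 1 / r := by linarith
  have hr0 : 0 < r := one_div_pos.1 hr1
  choose c hct hc using fun i => exists_setLIntegral_dyadicCube_le (hσm i) (hσA i) hη0
  set b : Fin n → ℝ≥0∞ := fun i => ENNReal.ofReal (2 * p i / (p i - 1)) * 2 ^ (p i - 1)
  have hbt : ∀ i, b i ≠ ⊤ := fun i => ENNReal.mul_ne_top ENNReal.ofReal_ne_top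
    (ENNReal.rpow_ne_top_of_nonneg (by linarith [hp i]) (by simp))
  have he0 : ENNReal.ofReal η ≠ 0 := (ENNReal.ofReal_pos.2 hη0).ne'
  set D : ℝ≥0∞ := (ENNReal.ofReal η)⁻¹ ^ (1 / r) * ∏ i, c i ^ (1 / p i) with hD
  have hDt : D ≠ ⊤ := ENNReal.mul_ne_top
    (ENNReal.rpow_ne_top_of_nonneg hr1.le (ENNReal.inv_ne_top.2 he0))
    (ENNReal.prod_ne_top fun i _ =>
      ENNReal.rpow_ne_top_of_nonneg (one_div_pos.2 (hp0 i)).le (hct i))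
  refine ⟨D * ∏ i, b i ^ (1 / p i), ENNReal.mul_ne_top hDt (ENNReal.prod_ne_top fun i _ =>
    ENNReal.rpow_ne_top_of_nonneg (one_div_pos.2 (hp0 i)).le (hbt i)), ?_⟩
  intro ι _ k m E hEm hES hηE hE K hA f hf
  set S := fun j => dyadicCube d (k j) (m j)
  set X : ι → ℝ≥0∞ := fun j => K j * volume (S j) ^ ((n : ℝ) - 1) *
    ∏ i, ((∫⁻ x in S j, σ i x) / volume (S j)) ^ (1 - 1 / p i)
  set Y : Fin n → ι → ℝ≥0∞ := fun i j =>
    ((∫⁻ x in S j, f i x * σ i x) / ∫⁻ x in S j, σ i x) ^ p i * ∫⁻ x in E j, σ i x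
  change (∑' j, X j ^ r * volume (E j)) ^ (1 / r) ≠ ⊤ at hA
  change _ ≤ _ * (∑' j, X j ^ r * volume (E j)) ^ (1 / r) * _
  have hSm : ∀ j, MeasurableSet (S j) := fun j => measurableSet_dyadicCube d _ _
  have hv0 : ∀ j, volume (S j) ≠ 0 := fun j => volume_dyadicCube_ne_zero d _ _
  have hvt : ∀ j, volume (S j) ≠ ⊤ := fun j => volume_dyadicCube_ne_top d _ _
  have hcarleson : ∀ i, ∑' j, Y i j ≤ b i * ∫⁻ x, f i x ^ p i * σ i x := by
    intro i
    have h := tsum_average_rpow_mul_measure_le (volume.withDensity (σ i)) hSm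
      (fun j j' => dyadicCube_nested_or_disjoint _ _ _ _) hEm hES hE (hf i) (hp i)
    rw [lintegral_withDensity_eq_lintegral_mul _ (hσm i) ((hf i).pow_const _)] at h
    simp only [setLIntegral_withDensity_eq_setLIntegral_mul _ (hσm i) (hf i) (hSm _),
      withDensity_apply _ (hSm _), withDensity_apply _ (hEm _), Pi.mul_apply,
      mul_comm (σ i _)] at h
    exact h
  have hXfin : ∀ j, X j ≠ ⊤ := by
    intro j hj
    have hE0 : volume (E j) ≠ 0 := fun h => by
      have := hηE j
      rw [h, nonpos_iff_eq_zero, mul_eq_zero] at this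
      exact this.elim he0 (hv0 j)
    refine hA ?_
    have : X j ^ r * volume (E j) = ⊤ := by
      rw [hj, ENNReal.top_rpow_of_pos hr0, ENNReal.top_mul hE0]
    rw [ENNReal.tsum_eq_top_of_eq_top ⟨j, this⟩, ENNReal.top_rpow_of_pos hr1]
  have hterm : ∀ j, K j * ∏ i, ∫⁻ x in S j, f i x * σ i x ≤
      D * ((X j ^ r * volume (E j)) ^ (1 / r) * ∏ i, Y i j ^ (1 / p i)) := by
    intro j
    by_cases hK : K j = 0
    · simp [hK]
    by_cases hW0 : ∃ i, ∫⁻ x in S j, σ i x = 0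
    · obtain ⟨i, hi⟩ := hW0
      have h0 : ∫⁻ x in S j, f i x * σ i x = 0 := by
        rw [lintegral_eq_zero_iff (hσm i)] at hi
        refine lintegral_eq_zero_of_ae_eq_zero ?_
        filter_upwards [hi] with x hx
        simp only [Pi.zero_apply] at hx ⊢
        rw [hx, mul_zero]
      rw [Finset.prod_eq_zero (Finset.mem_univ i) h0, mul_zero]
      exact zero_le
    push Not at hW0
    have hq : ∀ i, 0 < 1 - 1 / p i := fun i => by
      have := (div_lt_one (hp0 i)).2 (hp i)
      linarith
    have hWt : ∀ i, ∫⁻ x in S j, σ i x ≠ ⊤ := by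
      intro i hi
      refine hXfin j (ENNReal.mul_eq_top.2 (.inl ⟨?_, ?_⟩))
      · exact mul_ne_zero hK (ENNReal.rpow_pos (pos_iff_ne_zero.2 (hv0 j)) (hvt j)).ne'
      · rw [← Finset.mul_prod_erase _ _ (Finset.mem_univ i), hi, ENNReal.top_div_of_ne_top (hvt j),
          ENNReal.top_rpow_of_pos (hq i)]
        refine ENNReal.top_mul (Finset.prod_ne_zero_iff.2 fun l _ => ?_)
        rw [Ne, ENNReal.rpow_eq_zero_iff_of_pos (hq l)]
        exact (ENNReal.div_pos (hW0 l) (hvt j)).ne'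
    have hvol : volume (S j) ^ (1 / r) ≤
        (ENNReal.ofReal η)⁻¹ ^ (1 / r) * volume (E j) ^ (1 / r) := by
      rw [← ENNReal.mul_rpow_of_nonneg _ _ hr1.le]
      gcongr
      rw [mul_comm, ← div_eq_mul_inv, ENNReal.le_div_iff_mul_le (.inl he0) (.inl ofReal_ne_top),
        mul_comm]
      exact hηE j
    have hfactor : ∀ i, (∫⁻ x in S j, f i x * σ i x) / (∫⁻ x in S j, σ i x) *
        (∫⁻ x in S j, σ i x) ^ (1 / p i) ≤ c i ^ (1 / p i) * Y i j ^ (1 / p i) := by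
      intro i
      have hpi : 0 ≤ 1 / p i := (one_div_pos.2 (hp0 i)).le
      calc _ ≤ (∫⁻ x in S j, f i x * σ i x) / (∫⁻ x in S j, σ i x) *
          (c i * ∫⁻ x in E j, σ i x) ^ (1 / p i) := by
            gcongr
            exact hc i _ _ _ (hEm j) (hES j) (hηE j) (hWt i)
        _ = _ := by
            simp only [Y]
            rw [ENNReal.mul_rpow_of_nonneg _ _ hpi, ENNReal.mul_rpow_of_nonneg _ _ hpi,
              ← ENNReal.rpow_mul, mul_one_div_cancel (hp0 i).ne', ENNReal.rpow_one]
            ring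
    rw [mul_prod_eq_testing_mul_prod hp hr (hv0 j) (hvt j) (K j) hW0 hWt]
    calc _ ≤ X j * ((ENNReal.ofReal η)⁻¹ ^ (1 / r) * volume (E j) ^ (1 / r)) *
          ∏ i, (c i ^ (1 / p i) * Y i j ^ (1 / p i)) := by
          exact mul_le_mul' (mul_le_mul_right hvol _) (Finset.prod_le_prod' fun i _ => hfactor i)
      _ = _ := by
          rw [ENNReal.mul_rpow_of_nonneg _ _ hr1.le, ← ENNReal.rpow_mul,
            mul_one_div_cancel hr0.ne', ENNReal.rpow_one, Finset.prod_mul_distrib, hD]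
          ring
  calc ∑' j, K j * ∏ i, ∫⁻ x in S j, f i x * σ i x
      ≤ ∑' j, D * ((X j ^ r * volume (E j)) ^ (1 / r) * ∏ i, Y i j ^ (1 / p i)) :=
        ENNReal.tsum_le_tsum hterm
    _ ≤ D * ((∑' j, X j ^ r * volume (E j)) ^ (1 / r) * ∏ i, (∑' j, Y i j) ^ (1 / p i)) := by
        rw [ENNReal.tsum_mul_left]
        gcongr
        exact ENNReal.tsum_mul_prod_rpow_le _ _ hr hr1.le fun i => (one_div_pos.2 (hp0 i)).le
    _ ≤ D * ((∑' j, X j ^ r * volume (E j)) ^ (1 / r) *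
          ∏ i, (b i * ∫⁻ x, f i x ^ p i * σ i x) ^ (1 / p i)) := by
        gcongr with i
        · exact (one_div_pos.2 (hp0 i)).le
        · exact hcarleson i
    _ = _ := by
        simp_rw [fun i => ENNReal.mul_rpow_of_nonneg (b i) (∫⁻ x, f i x ^ p i * σ i x)
          (one_div_pos.2 (hp0 i)).le]
        rw [Finset.prod_mul_distrib]
        ring
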